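/- arXiv:2402.11482 — 2 statements merged into one kernel-verified Lean document; each statement's English description precedes it below -/
import Mathlib

section
/- Let T > 0, let B₀ ⊂ B ⊂ B₁ be Banach spaces with continuous embeddings, where B₀ and B₁ are reflexive and the embedding B₀ ⊂ B is compact. Let 1 < r < ∞ and 0 < α < 1. Then the embedding L^r([0,T];B₀) ∩ 𝒲^{α,r}([0,T];B₁) ⊂ L^r([0,T];B) is compact; that is, every sequence (u_n) of strongly measurable functions [0,T] → B₀ with sup_n ( ‖u_n‖_{L^r([0,T];B₀)} + ‖u_n‖_{𝒲^{α,r}([0,T];B₁)} ) < ∞ has a subsequence that converges in L^r([0,T];B). -/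
open MeasureTheory Filter Set
open scoped ENNReal NNReal

lemma ehrling0 {B₀ B B₁ : Type*}
    [NormedAddCommGroup B₀] [NormedSpace ℝ B₀]
    [NormedAddCommGroup B] [NormedSpace ℝ B]
    [NormedAddCommGroup B₁] [NormedSpace ℝ B₁]
    (i₀ : B₀ →L[ℝ] B) (i₁ : B →L[ℝ] B₁)
    (hi₁inj : Function.Injective i₁)
    (hcpt : IsCompactOperator i₀) (ε : ℝ) (hε : 0 < ε) :
    ∃ C : ℝ, 0 ≤ C ∧ ∀ x, ‖i₀ x‖ ≤ ε * ‖x‖ + C * ‖i₁ (i₀ x)‖ := by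
  by_contra! H
  have h1 : ∀ n : ℕ, ∃ x : B₀, ‖x‖ ≤ 1 ∧ ε * ‖x‖ + n * ‖i₁ (i₀ x)‖ < ‖i₀ x‖ ∧ ‖x‖ = 1 := by
    intro n
    obtain ⟨x, hx⟩ := H n n.cast_nonneg
    have hx0 : x ≠ 0 := by
      rintro rfl
      simp at hx
    have hp : 0 < ‖x‖ := norm_pos_iff.2 hx0
    have hn : ‖(‖x‖⁻¹ : ℝ) • x‖ = 1 := by
      rw [norm_smul, norm_inv, norm_norm, inv_mul_cancel₀ hp.ne']
    refine ⟨(‖x‖⁻¹ : ℝ) • x, hn.le, ?_, hn⟩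
    rw [hn]
    simp only [map_smul, norm_smul, norm_inv, norm_norm]
    have := mul_lt_mul_of_pos_left hx (inv_pos.2 hp)
    calc _ = ‖x‖⁻¹ * (ε * ‖x‖ + n * ‖i₁ (i₀ x)‖) := by field_simp
      _ < _ := this
  choose x hx1 hx2 hx3 using h1
  obtain ⟨K, hK, hKs⟩ := IsCompactOperator.image_closedBall_subset_compact (f := (i₀ : B₀ →ₗ[ℝ] B)) hcpt 1
  have hmem : ∀ n, i₀ (x n) ∈ K := fun n => hKs ⟨x n, by simpa using hx1 n, rfl⟩
  obtain ⟨y, hyK, φ, hφ, hlim⟩ := hK.tendsto_subseq hmem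
  obtain ⟨R, hR⟩ := hK.isBounded.exists_norm_le
  have hy : i₁ y = 0 := by
    have ha : Tendsto (fun n => i₁ (i₀ (x (φ n)))) atTop (nhds (i₁ y)) :=
      (i₁.continuous.tendsto y).comp hlim
    refine tendsto_nhds_unique ha ?_
    have hz : Tendsto (fun n : ℕ => R / (φ n : ℝ)) atTop (nhds 0) :=
      (tendsto_const_div_atTop_nhds_zero_nat R).comp hφ.tendsto_atTop
    refine squeeze_zero_norm' ?_ hz
    filter_upwards [hφ.tendsto_atTop.eventually_gt_atTop 0] with n hn
    have hn' : (0:ℝ) < φ n := by exact_mod_cast hn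
    rw [le_div_iff₀ hn', mul_comm]
    have := hx2 (φ n)
    rw [hx3] at this
    have := hR _ (hmem (φ n))
    linarith
  have hy0 : y = 0 := hi₁inj (by simpa using hy)
  have h2 : ε ≤ ‖y‖ := by
    refine le_of_tendsto_of_tendsto' tendsto_const_nhds hlim.norm fun n => ?_
    have := hx2 (φ n)
    rw [hx3] at this
    have h3 : 0 ≤ (φ n : ℝ) * ‖i₁ (i₀ (x (φ n)))‖ := by positivity
    simp only [Function.comp]
    linarith
  rw [hy0, norm_zero] at h2
  linarith

lemma ehrling {B₀ B B₁ : Type*}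
    [NormedAddCommGroup B₀] [NormedSpace ℝ B₀]
    [NormedAddCommGroup B] [NormedSpace ℝ B]
    [NormedAddCommGroup B₁] [NormedSpace ℝ B₁]
    (i₀ : B₀ →L[ℝ] B) (i₁ : B →L[ℝ] B₁)
    (hi₁inj : Function.Injective i₁)
    (hcpt : IsCompactOperator i₀) (r : ℝ) (hr : 1 < r) (ε : ℝ≥0) (hε : 0 < ε) :
    ∃ C : ℝ≥0∞, C ≠ ⊤ ∧ ∀ x, ‖i₀ x‖ₑ ^ r ≤ ε * ‖x‖ₑ ^ r + C * ‖i₁ (i₀ x)‖ₑ ^ r := by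
  have hr0 : 0 < r := by linarith
  set c : ℝ≥0∞ := 2 ^ (r - 1) with hc
  have hct : c ≠ ⊤ := by simp [hc]
  obtain ⟨e, he0, he⟩ := ENNReal.exists_nnreal_pos_mul_lt (a := c) (b := ε) hct (by simpa using hε.ne')
  set e' : ℝ≥0 := e ^ (1/r) with he'
  have he'r : (e' : ℝ≥0∞) ^ r = e := by
    rw [he', ← ENNReal.coe_rpow_of_nonneg _ hr0.le, ← NNReal.rpow_mul]
    simp [hr0.ne']
  obtain ⟨C, hC0, hC⟩ := ehrling0 i₀ i₁ hi₁inj hcpt e' (NNReal.rpow_pos he0)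
  refine ⟨c * ENNReal.ofReal C ^ r, ENNReal.mul_ne_top hct (by simp [hr0.le]), fun x => ?_⟩
  have h1 : ‖i₀ x‖ₑ ≤ e' * ‖x‖ₑ + ENNReal.ofReal C * ‖i₁ (i₀ x)‖ₑ := by
    have := ENNReal.ofReal_le_ofReal (hC x)
    rw [ENNReal.ofReal_add (by positivity) (by positivity), ENNReal.ofReal_mul (by positivity),
      ENNReal.ofReal_mul hC0] at this
    simpa [ofReal_norm] using this
  calc ‖i₀ x‖ₑ ^ r ≤ (e' * ‖x‖ₑ + ENNReal.ofReal C * ‖i₁ (i₀ x)‖ₑ) ^ r := by gcongr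
    _ ≤ c * ((e' * ‖x‖ₑ) ^ r + (ENNReal.ofReal C * ‖i₁ (i₀ x)‖ₑ) ^ r) := by
        have := ENNReal.rpow_add_le_mul_rpow_add_rpow (e' * ‖x‖ₑ) (ENNReal.ofReal C * ‖i₁ (i₀ x)‖ₑ) hr.le
        simpa [hc] using this
    _ = e * c * ‖x‖ₑ ^ r + c * ENNReal.ofReal C ^ r * ‖i₁ (i₀ x)‖ₑ ^ r := by
        rw [ENNReal.mul_rpow_of_nonneg _ _ hr0.le, ENNReal.mul_rpow_of_nonneg _ _ hr0.le, he'r]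
        ring
    _ ≤ _ := by gcongr

lemma piece {B₀ B B₁ : Type*}
    [NormedAddCommGroup B₀] [NormedSpace ℝ B₀]
    [NormedAddCommGroup B] [NormedSpace ℝ B]
    [NormedAddCommGroup B₁] [NormedSpace ℝ B₁]
    (i : B₀ →L[ℝ] B) (j : B₀ →L[ℝ] B₁) (r α : ℝ) (hr : 1 < r) (hα : 0 < α)
    (u : ℝ → B₀) (hu : StronglyMeasurable u) (ε C : ℝ≥0∞)
    (hE : ∀ x, ‖i x‖ₑ ^ r ≤ ε * ‖x‖ₑ ^ r + C * ‖j x‖ₑ ^ r)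
    (I J : Set ℝ) (hI : MeasurableSet I) (hIJ : I ⊆ J) (δ : ℝ) (hδ : 0 < δ)
    (hvol : volume I = ENNReal.ofReal δ) (hdiam : ∀ t ∈ I, ∀ s ∈ I, |t - s| ≤ δ)
    (Q : ℝ≥0∞)
    (hQ : Q = (∫⁻ t in I, ‖u t‖ₑ ^ r) + ∫⁻ t in I, ∫⁻ s in J, 
        ‖j (u t) - j (u s)‖ₑ ^ r / ENNReal.ofReal (|t - s| ^ (1 + α * r))) :
    ∃ s ∈ I, ENNReal.ofReal δ * ‖u s‖ₑ ^ r ≤ Q ∧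
      ∫⁻ t in I, ‖i (u t) - i (u s)‖ₑ ^ r ≤
        (ε * (2 ^ (r-1) * 2) + C * ENNReal.ofReal (δ ^ (α * r))) * Q := by
  have hr0 : 0 < r := by linarith
  have hum : Measurable fun t => ‖u t‖ₑ ^ r := (hu.enorm).pow_const r
  have hj : StronglyMeasurable fun t => j (u t) := j.continuous.comp_stronglyMeasurable hu
  have hδ0 : ENNReal.ofReal δ ≠ 0 := by simpa using hδ
  set q : ℝ → ℝ → ℝ≥0∞ := fun t s => 
    ‖j (u t) - j (u s)‖ₑ ^ r / ENNReal.ofReal (|t - s| ^ (1 + α * r)) with hq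
  have hqm : Measurable fun p : ℝ × ℝ => q p.1 p.2 := by
    refine Measurable.div ?_ ?_
    · exact (((hj.comp_measurable measurable_fst).sub (hj.comp_measurable measurable_snd)).enorm).pow_const r
    · fun_prop
  have hGm : Measurable fun t => ∫⁻ s in I, q t s := hqm.lintegral_prod_right'
  obtain ⟨s, hs, hsle⟩ := exists_le_setLAverage (μ := volume) (s := I)
    (f := fun t => ‖u t‖ₑ ^ r + ∫⁻ s in I, q t s) (by rw [hvol]; exact hδ0)
    (by rw [hvol]; simp) (hum.add hGm).aemeasurable
  rw [setLAverage_eq, hvol, ENNReal.le_div_iff_mul_le (Or.inl hδ0) (Or.inl (by simp)),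
    lintegral_add_left hum] at hsle
  have hsQ : (‖u s‖ₑ ^ r + ∫⁻ t in I, q s t) * ENNReal.ofReal δ ≤ Q := by
    refine hsle.trans ?_
    rw [hQ]
    gcongr
  have hsQ1 : ENNReal.ofReal δ * ‖u s‖ₑ ^ r ≤ Q := by
    refine le_trans ?_ hsQ
    rw [mul_comm]
    gcongr
    exact le_self_add
  refine ⟨s, hs, hsQ1, ?_⟩
  have hw : ∫⁻ t in I, ‖j (u t) - j (u s)‖ₑ ^ r ≤ ENNReal.ofReal (δ ^ (α * r)) * Q := by
    calc ∫⁻ t in I, ‖j (u t) - j (u s)‖ₑ ^ r 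
        ≤ ∫⁻ t in I, ENNReal.ofReal (δ ^ (1 + α * r)) * q s t := by
          refine setLIntegral_mono_ae' hI (ae_of_all _ fun t ht => ?_)
          rcases eq_or_ne s t with rfl | hne
          · simp [hr0]
          · have hp : 0 < |s - t| := abs_pos.2 (sub_ne_zero.2 hne)
            have hp2 : ENNReal.ofReal (|s - t| ^ (1 + α * r)) ≠ 0 := by
              simpa using Real.rpow_pos_of_pos hp _
            calc ‖j (u t) - j (u s)‖ₑ ^ r = ENNReal.ofReal (|s - t| ^ (1 + α * r)) * q s t := by
                  rw [hq]
                  simp only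
                  rw [ENNReal.mul_div_cancel hp2 (by simp), ← enorm_neg, neg_sub]
              _ ≤ _ := by
                  gcongr
                  exact hdiam s hs t ht
      _ = ENNReal.ofReal (δ ^ (1 + α * r)) * ∫⁻ t in I, q s t := by
          rw [lintegral_const_mul]
          exact hqm.comp measurable_prodMk_left
      _ = ENNReal.ofReal (δ ^ (α * r)) * ((∫⁻ t in I, q s t) * ENNReal.ofReal δ) := by
          rw [Real.rpow_add hδ, Real.rpow_one, ENNReal.ofReal_mul hδ.le]
          ring
      _ ≤ ENNReal.ofReal (δ ^ (α * r)) * Q := by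
          gcongr
          refine le_trans ?_ hsQ
          gcongr
          exact le_add_self
  have hu2 : ∫⁻ t in I, ‖u t - u s‖ₑ ^ r ≤ (2 ^ (r-1) * 2) * Q := by
    calc ∫⁻ t in I, ‖u t - u s‖ₑ ^ r ≤ ∫⁻ t in I, 2 ^ (r-1) * (‖u t‖ₑ ^ r + ‖u s‖ₑ ^ r) := by
          refine lintegral_mono fun t => ?_
          refine le_trans ?_ (ENNReal.rpow_add_le_mul_rpow_add_rpow _ _ hr.le)
          gcongr
          exact enorm_sub_le
      _ = 2 ^ (r-1) * ((∫⁻ t in I, ‖u t‖ₑ ^ r) + ENNReal.ofReal δ * ‖u s‖ₑ ^ r) := by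
          rw [lintegral_const_mul _ (by fun_prop), lintegral_add_left hum, setLIntegral_const, hvol,
            mul_comm (ENNReal.ofReal δ)]
      _ ≤ 2 ^ (r-1) * (Q + Q) := by
          gcongr
          rw [hQ]
          exact le_self_add
      _ = _ := by ring
  have hd : Measurable fun t => ‖u t - u s‖ₑ ^ r :=
    ((hu.sub stronglyMeasurable_const).enorm).pow_const r
  have hd2 : Measurable fun t => ‖j (u t) - j (u s)‖ₑ ^ r :=
    ((hj.sub stronglyMeasurable_const).enorm).pow_const r
  calc ∫⁻ t in I, ‖i (u t) - i (u s)‖ₑ ^ r 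
      ≤ ∫⁻ t in I, (ε * ‖u t - u s‖ₑ ^ r + C * ‖j (u t) - j (u s)‖ₑ ^ r) := by
        refine lintegral_mono fun t => ?_
        simpa only [map_sub] using hE (u t - u s)
    _ = ε * (∫⁻ t in I, ‖u t - u s‖ₑ ^ r) + C * ∫⁻ t in I, ‖j (u t) - j (u s)‖ₑ ^ r := by
        rw [lintegral_add_left (hd.const_mul _), lintegral_const_mul _ hd, lintegral_const_mul _ hd2]
    _ ≤ ε * ((2 ^ (r-1) * 2) * Q) + C * (ENNReal.ofReal (δ ^ (α * r)) * Q) := by gcongr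
    _ = _ := by ring

lemma sum_pieces (f : ℝ → ℝ≥0∞) (δ : ℝ) (hδ : 0 < δ) (N : ℕ) :
    ∑ k ∈ Finset.range N, ∫⁻ t in Ico (k * δ) ((k + 1) * δ), f t = ∫⁻ t in Ico 0 (N * δ), f t := by
  induction N with
  | zero => simp
  | succ n ih =>
    rw [Finset.sum_range_succ, ih, ← lintegral_union measurableSet_Ico, 
      Ico_union_Ico_eq_Ico (by positivity)]
    · push_cast; rfl
    · nlinarith
    · rw [Set.disjoint_left]
      intro x hx hx'
      exact absurd hx.2 (not_lt.2 hx'.1)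

noncomputable def stepIdx (N : ℕ) (δ : ℝ) (t : ℝ) : Fin (N + 1) := Fin.ofNat (N + 1) ⌊t / δ⌋₊

lemma stepIdx_meas (N : ℕ) (δ : ℝ) : Measurable (stepIdx N δ) := by
  unfold stepIdx
  exact (measurable_from_top (f := fun n : ℕ => Fin.ofNat (N + 1) n)).comp
    (Nat.measurable_floor.comp (measurable_id.div_const δ))

lemma stepIdx_eq (N : ℕ) (δ : ℝ) (hδ : 0 < δ) (k : ℕ) (hk : k < N + 1) (t : ℝ)
    (ht : t ∈ Ico (k * δ) ((k + 1) * δ)) : stepIdx N δ t = ⟨k, hk⟩ := by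
  have : ⌊t / δ⌋₊ = k := by
    rw [Nat.floor_eq_iff (div_nonneg (le_trans (by positivity) ht.1) hδ.le)]
    exact ⟨(le_div_iff₀ hδ).2 ht.1, (div_lt_iff₀ hδ).2 ht.2⟩
  unfold stepIdx
  rw [this]
  ext
  simp [Fin.ofNat, Nat.mod_eq_of_lt hk]

lemma approx {B₀ B B₁ : Type*}
    [NormedAddCommGroup B₀] [NormedSpace ℝ B₀]
    [NormedAddCommGroup B] [NormedSpace ℝ B]
    [NormedAddCommGroup B₁] [NormedSpace ℝ B₁]
    (i : B₀ →L[ℝ] B) (j : B₀ →L[ℝ] B₁) (r α : ℝ) (hr : 1 < r) (hα : 0 < α)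
    (u : ℝ → B₀) (hu : StronglyMeasurable u) (ε C : ℝ≥0∞)
    (hE : ∀ x, ‖i x‖ₑ ^ r ≤ ε * ‖x‖ₑ ^ r + C * ‖j x‖ₑ ^ r)
    (T : ℝ) (hT : 0 < T) (N : ℕ) (A : ℝ≥0∞)
    (hA1 : ∫⁻ t in Icc 0 T, ‖u t‖ₑ ^ r ≤ A)
    (hA2 : ∫⁻ t in Icc 0 T, ∫⁻ s in Icc 0 T, 
        ‖j (u t) - j (u s)‖ₑ ^ r / ENNReal.ofReal (|t - s| ^ (1 + α * r)) ≤ A) 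
    (δ : ℝ) (hδ : δ = T / (N + 1 : ℕ)) :
    ∃ y : Fin (N + 1) → B₀, (∀ k, ENNReal.ofReal δ * ‖y k‖ₑ ^ r ≤ 2 * A) ∧
      ∫⁻ t in Icc 0 T, ‖i (u t) - i (y (stepIdx N δ t))‖ₑ ^ r ≤
        (ε * (2 ^ (r-1) * 2) + C * ENNReal.ofReal (δ ^ (α * r))) * (2 * A) := by
  have hδ0 : 0 < δ := by rw [hδ]; positivity
  have hNδ : ((N + 1 : ℕ) : ℝ) * δ = T := by rw [hδ]; field_simp
  have hres : (volume.restrict (Icc (0:ℝ) T)) = volume.restrict (Ico 0 T) :=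
    (Measure.restrict_congr_set Ico_ae_eq_Icc).symm
  set I : ℕ → Set ℝ := fun k => Ico (k * δ) ((k + 1) * δ) with hI
  set P : ℝ → ℝ≥0∞ := fun t => ∫⁻ s in Icc 0 T, 
        ‖j (u t) - j (u s)‖ₑ ^ r / ENNReal.ofReal (|t - s| ^ (1 + α * r)) with hP
  set Q : ℕ → ℝ≥0∞ := fun k => (∫⁻ t in I k, ‖u t‖ₑ ^ r) + ∫⁻ t in I k, P t with hQ
  have hsum : ∑ k ∈ Finset.range (N + 1), Q k ≤ 2 * A := by
    rw [hQ, Finset.sum_add_distrib, sum_pieces _ _ hδ0, sum_pieces _ _ hδ0, hNδ, ← hres, two_mul]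
    gcongr
  have hex : ∀ k : Fin (N + 1), ∃ s ∈ I k, ENNReal.ofReal δ * ‖u s‖ₑ ^ r ≤ Q k ∧
      ∫⁻ t in I k, ‖i (u t) - i (u s)‖ₑ ^ r ≤
        (ε * (2 ^ (r-1) * 2) + C * ENNReal.ofReal (δ ^ (α * r))) * Q k := by
    intro k
    refine piece i j r α hr hα u hu ε C hE (I k) (Icc 0 T) measurableSet_Ico ?_ δ hδ0 ?_ ?_ (Q k) rfl
    · intro t ht
      have hk : ((k : ℕ) : ℝ) + 1 ≤ (N + 1 : ℕ) := by exact_mod_cast k.2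
      refine ⟨le_trans (by positivity) ht.1, ht.2.le.trans ?_⟩
      rw [← hNδ]
      gcongr
    · simp only [hI, Real.volume_Ico]
      congr 1
      ring
    · intro t ht s hs
      have h1 := ht.1
      have h2 := ht.2
      have h3 := hs.1
      have h4 := hs.2
      rw [abs_le]
      constructor <;> linarith
  choose s hs h1 h2 using hex
  refine ⟨fun k => u (s k), fun k => (h1 k).trans (le_trans ?_ hsum), ?_⟩
  · exact Finset.single_le_sum (f := Q) (fun _ _ => zero_le) (Finset.mem_range.2 k.2)
  · rw [hres, ← hNδ, ← sum_pieces _ _ hδ0]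
    calc _ ≤ ∑ k ∈ Finset.range (N + 1), 
          (ε * (2 ^ (r-1) * 2) + C * ENNReal.ofReal (δ ^ (α * r))) * Q k := by
          refine Finset.sum_le_sum fun k hk => ?_
          have hk' := Finset.mem_range.1 hk
          refine le_trans (le_of_eq ?_) (h2 ⟨k, hk'⟩)
          refine setLIntegral_congr_fun measurableSet_Ico fun t ht => ?_
          simp only
          rw [stepIdx_eq N δ hδ0 k hk' t ht]
      _ ≤ _ := by
          rw [← Finset.mul_sum]
          gcongr

lemma compact_steps {E : Type*} [NormedAddCommGroup E] (μ : Measure ℝ) [IsFiniteMeasure μ]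
    (p : ℝ≥0∞) [Fact (1 ≤ p)] (N : ℕ) (δ : ℝ) (K : Set E) (hK : IsCompact K) :
    ∃ S : Set (Lp E p μ), IsCompact S ∧ ∀ y : Fin (N + 1) → E, (∀ k, y k ∈ K) →
      ∃ h : MemLp (fun t => y (stepIdx N δ t)) p μ, h.toLp _ ∈ S := by
  have hmem : ∀ y : Fin (N + 1) → E, MemLp (fun t => y (stepIdx N δ t)) p μ := fun y =>
    MemLp.of_bound ((StronglyMeasurable.of_discrete (f := y)).comp_measurable
      (stepIdx_meas N δ)).aestronglyMeasurable ‖y‖ (ae_of_all _ fun t => norm_le_pi_norm y _)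
  set F : (Fin (N + 1) → E) → Lp E p μ := fun y => (hmem y).toLp _ with hF
  have hc : Continuous F := by
    have : LipschitzWith (μ univ ^ p.toReal⁻¹).toNNReal F := by
      intro y z
      rw [hF]
      simp only
      rw [Lp.edist_toLp_toLp, edist_eq_enorm_sub, ENNReal.coe_toNNReal (by
        exact ENNReal.rpow_ne_top_of_nonneg (by positivity) (measure_ne_top _ _)), ← ofReal_norm]
      refine eLpNorm_le_of_ae_bound (ae_of_all _ fun t => ?_)
      exact norm_le_pi_norm (y - z) _
    exact this.continuous
  refine ⟨F '' (Set.univ.pi fun _ => K), (isCompact_univ_pi fun _ => hK).image hc, fun y hy => 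
    ⟨hmem y, y, by simpa using hy, rfl⟩⟩

lemma totBdd_of_approx {X : Type*} [PseudoMetricSpace X] (s : Set X)
    (h : ∀ ε > 0, ∃ S : Set X, IsCompact S ∧ ∀ x ∈ s, ∃ y ∈ S, dist x y < ε) : TotallyBounded s := by
  rw [Metric.totallyBounded_iff]
  intro ε hε
  obtain ⟨S, hS, hd⟩ := h (ε/2) (half_pos hε)
  obtain ⟨t, ht, hcov⟩ := Metric.totallyBounded_iff.1 hS.totallyBounded (ε/2) (half_pos hε)
  refine ⟨t, ht, fun x hx => ?_⟩
  obtain ⟨y, hy, hxy⟩ := hd x hx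
  have := hcov hy
  simp only [mem_iUnion, Metric.mem_ball, exists_prop] at this ⊢
  obtain ⟨z, hz, hyz⟩ := this
  exact ⟨z, hz, by linarith [dist_triangle x y z]⟩

lemma totBdd {B₀ B B₁ : Type*}
    [NormedAddCommGroup B₀] [NormedSpace ℝ B₀]
    [NormedAddCommGroup B] [NormedSpace ℝ B]
    [NormedAddCommGroup B₁] [NormedSpace ℝ B₁]
    (i : B₀ →L[ℝ] B) (j : B₀ →L[ℝ] B₁) (hi : IsCompactOperator i)
    (r α : ℝ) (hr : 1 < r) (hα : 0 < α)
    (hE : ∀ ε : ℝ≥0, 0 < ε → ∃ C : ℝ≥0∞, C ≠ ⊤ ∧ 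
      ∀ x, ‖i x‖ₑ ^ r ≤ ε * ‖x‖ₑ ^ r + C * ‖j x‖ₑ ^ r)
    (T : ℝ) (hT : 0 < T) (A : ℝ≥0∞) (hA : A ≠ ⊤)
    (u : ℕ → ℝ → B₀) (hu : ∀ n, StronglyMeasurable (u n))
    (hA1 : ∀ n, ∫⁻ t in Icc 0 T, ‖u n t‖ₑ ^ r ≤ A)
    (hA2 : ∀ n, ∫⁻ t in Icc 0 T, ∫⁻ s in Icc 0 T, 
        ‖j (u n t) - j (u n s)‖ₑ ^ r / ENNReal.ofReal (|t - s| ^ (1 + α * r)) ≤ A)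
    [Fact (1 ≤ ENNReal.ofReal r)]
    (hmem : ∀ n, MemLp (fun t => i (u n t)) (ENNReal.ofReal r) (volume.restrict (Icc 0 T))) :
    TotallyBounded (range fun n => (hmem n).toLp _) := by
  have hr0 : 0 < r := by linarith
  refine totBdd_of_approx _ fun η hη => ?_
  set e : ℝ≥0∞ := ENNReal.ofReal η ^ r with he
  have he0 : e ≠ 0 := by
    rw [he]; simp [hη, hr0.le]
  have he2 : e / 2 ≠ 0 := by simpa using he0
  obtain ⟨ε, hε0, hε⟩ := ENNReal.exists_nnreal_pos_mul_lt 
    (a := 2 ^ (r-1) * 2 * (2 * A)) (b := e / 2) (by finiteness) he2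
  obtain ⟨C, hC, hEC⟩ := hE ε hε0
  have hlim : Tendsto (fun N : ℕ => C * ENNReal.ofReal ((T / (N + 1 : ℕ)) ^ (α * r)) * (2 * A)) 
      atTop (nhds 0) := by
    have h1 : Tendsto (fun N : ℕ => T / ((N + 1 : ℕ) : ℝ)) atTop (nhds 0) :=
      (tendsto_const_div_atTop_nhds_zero_nat T).comp (tendsto_add_atTop_nat 1)
    have h2 := h1.rpow_const (p := α * r) (Or.inr (by positivity))
    rw [Real.zero_rpow (by positivity)] at h2
    have h3 := ENNReal.tendsto_ofReal h2
    rw [ENNReal.ofReal_zero] at h3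
    have h4 := ENNReal.Tendsto.mul_const (b := 2 * A) (ENNReal.Tendsto.const_mul (a := C) h3 (Or.inr hC))
      (Or.inr (by finiteness))
    simpa using h4
  obtain ⟨N, hN⟩ := (hlim.eventually_lt_const (pos_iff_ne_zero.2 he2)).exists
  set δ : ℝ := T / (N + 1 : ℕ) with hδ
  have hδ0 : 0 < δ := by rw [hδ]; positivity
  have hδe : ENNReal.ofReal δ ≠ 0 := by simpa using hδ0
  set R : ℝ≥0∞ := (2 * A / ENNReal.ofReal δ) ^ (1 / r) with hR
  have hRt : R ≠ ⊤ := ENNReal.rpow_ne_top_of_nonneg (by positivity) 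
    (ENNReal.div_ne_top (by finiteness) hδe)
  obtain ⟨K, hK, hKs⟩ := IsCompactOperator.image_closedBall_subset_compact 
    (f := (i : B₀ →ₗ[ℝ] B)) hi R.toReal
  obtain ⟨S, hS, hSK⟩ := compact_steps (volume.restrict (Icc 0 T)) (ENNReal.ofReal r) N δ K hK
  refine ⟨S, hS, ?_⟩
  rintro _ ⟨n, rfl⟩
  obtain ⟨y, hy1, hy2⟩ := approx i j r α hr hα (u n) (hu n) ε C hEC T hT N A (hA1 n) (hA2 n) δ hδ
  have hyK : ∀ k, i (y k) ∈ K := fun k => by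
    refine hKs ⟨y k, ?_, rfl⟩
    rw [mem_closedBall_zero_iff]
    have h1 : ‖y k‖ₑ ≤ R := by
      rw [hR, one_div, ENNReal.le_rpow_inv_iff hr0, 
        ENNReal.le_div_iff_mul_le (Or.inl hδe) (Or.inl (by simp)), mul_comm]
      exact hy1 k
    simpa using ENNReal.toReal_mono hRt h1
  obtain ⟨hm, hmS⟩ := hSK (fun k => i (y k)) hyK
  refine ⟨_, hmS, ?_⟩
  rw [← edist_lt_ofReal, Lp.edist_toLp_toLp, eLpNorm_eq_lintegral_rpow_enorm_toReal
    (by simpa using hr0) (by simp), ENNReal.toReal_ofReal hr0.le, one_div, 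
    ENNReal.rpow_inv_lt_iff hr0, ← he]
  refine lt_of_le_of_lt hy2 ?_
  calc _ = ε * (2 ^ (r-1) * 2 * (2 * A)) + C * ENNReal.ofReal (δ ^ (α * r)) * (2 * A) := by ring
    _ < e / 2 + e / 2 := ENNReal.add_lt_add hε hN
    _ = e := ENNReal.add_halves e

/-- Compact embedding of `L^r([0,T];B₀) ∩ 𝒲^{α,r}([0,T];B₁)` into `L^r([0,T];B)`
(Flandoli–Gątarek, Theorem 2.1). -/
theorem stmt_0
    {B₀ B B₁ : Type*}
    [NormedAddCommGroup B₀] [NormedSpace ℝ B₀]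
    [NormedAddCommGroup B] [NormedSpace ℝ B]
    [NormedAddCommGroup B₁] [NormedSpace ℝ B₁]
    (i₀ : B₀ →L[ℝ] B) (i₁ : B →L[ℝ] B₁)
    (hi₀inj : Function.Injective i₀) (hi₁inj : Function.Injective i₁)
    (hreflB₀ : Function.Surjective (NormedSpace.inclusionInDoubleDual ℝ B₀))
    (hreflB₁ : Function.Surjective (NormedSpace.inclusionInDoubleDual ℝ B₁))
    (hcpt : IsCompactOperator i₀)
    (T : ℝ) (hT : 0 < T)
    (r α : ℝ) (hr : 1 < r) (hα : α ∈ Ioo (0:ℝ) 1)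
    (u : ℕ → ℝ → B₀)
    (hmeas : ∀ n, StronglyMeasurable (u n))
    (M : ℝ≥0∞) (hM : M < ⊤)
    (hbdd : ∀ n,
      (∫⁻ t in Icc (0:ℝ) T, (‖u n t‖₊ : ℝ≥0∞) ^ r) ^ (1/r)
        + ((∫⁻ t in Icc (0:ℝ) T, (‖i₁ (i₀ (u n t))‖₊ : ℝ≥0∞) ^ r)
            + ∫⁻ t in Icc (0:ℝ) T, ∫⁻ s in Icc (0:ℝ) T,
                (‖i₁ (i₀ (u n t)) - i₁ (i₀ (u n s))‖₊ : ℝ≥0∞) ^ r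
                  / ENNReal.ofReal (|t - s| ^ (1 + α * r))) ^ (1/r)
        ≤ M) :
    ∃ φ : ℕ → ℕ, StrictMono φ ∧ ∃ v : ℝ → B,
      AEStronglyMeasurable v (volume.restrict (Icc (0:ℝ) T)) ∧
      (∫⁻ t in Icc (0:ℝ) T, (‖v t‖₊ : ℝ≥0∞) ^ r) < ⊤ ∧
      Tendsto (fun k => ∫⁻ t in Icc (0:ℝ) T,
          (‖i₀ (u (φ k) t) - v t‖₊ : ℝ≥0∞) ^ r) atTop (nhds 0) := by
  have hr0 : 0 < r := by linarith
  have : Fact (1 ≤ ENNReal.ofReal r) := ⟨by simpa using hr.le⟩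
  have hp0 : ENNReal.ofReal r ≠ 0 := by simpa using hr0
  have hpt : ENNReal.ofReal r ≠ ⊤ := by simp
  have hpr : (ENNReal.ofReal r).toReal = r := ENNReal.toReal_ofReal hr0.le
  simp only [← enorm_eq_nnnorm] at hbdd ⊢
  set A : ℝ≥0∞ := M ^ r with hA
  have hAt : A ≠ ⊤ := ENNReal.rpow_ne_top_of_nonneg hr0.le hM.ne
  have hA1 : ∀ n, ∫⁻ t in Icc 0 T, ‖u n t‖ₑ ^ r ≤ A := fun n => by
    rw [hA, ← ENNReal.rpow_inv_le_iff hr0, ← one_div]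
    exact le_self_add.trans (hbdd n)
  have hA2 : ∀ n, ∫⁻ t in Icc 0 T, ∫⁻ s in Icc 0 T, 
        ‖(i₁ ∘L i₀) (u n t) - (i₁ ∘L i₀) (u n s)‖ₑ ^ r 
          / ENNReal.ofReal (|t - s| ^ (1 + α * r)) ≤ A := fun n => by
    have h1 := le_add_self.trans (hbdd n)
    rw [one_div, ENNReal.rpow_inv_le_iff hr0] at h1
    exact le_add_self.trans h1
  set c : B →ₗᵢ[ℝ] UniformSpace.Completion B := UniformSpace.Completion.toComplₗᵢ with hc
  set i : B₀ →L[ℝ] UniformSpace.Completion B := c.toContinuousLinearMap ∘L i₀ with hi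
  have hiapp : ∀ x, i x = c (i₀ x) := fun x => rfl
  have hicpt : IsCompactOperator i := hcpt.clm_comp c.toContinuousLinearMap
  have hmem : ∀ n, MemLp (fun t => i (u n t)) (ENNReal.ofReal r) (volume.restrict (Icc 0 T)) := by
    intro n
    have h0 : MemLp (u n) (ENNReal.ofReal r) (volume.restrict (Icc 0 T)) := by
      refine ⟨(hmeas n).aestronglyMeasurable, ?_⟩
      rw [eLpNorm_lt_top_iff_lintegral_rpow_enorm_lt_top hp0 hpt, hpr]
      exact (hA1 n).trans_lt hAt.lt_top
    exact i.comp_memLp' h0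
  have htb := totBdd i (i₁ ∘L i₀) hicpt r α hr hα.1 (fun ε hε => by
    obtain ⟨C, hC, h⟩ := ehrling i₀ i₁ hi₁inj hcpt r hr ε hε
    refine ⟨C, hC, fun x => ?_⟩
    rw [hiapp, LinearIsometry.enorm_map]
    exact h x) T hT A hAt u hmeas hA1 hA2 hmem
  obtain ⟨V, -, φ, hφ, hV⟩ := (htb.closure.isCompact_of_isClosed isClosed_closure).tendsto_subseq
    (x := fun n => (hmem n).toLp _) (fun n => subset_closure ⟨n, rfl⟩)
  obtain ⟨ψ, hψ, hae⟩ := (tendstoInMeasure_of_tendsto_Lp hV).exists_seq_tendsto_ae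
  have hcoe : ∀ᵐ t ∂(volume.restrict (Icc 0 T)), ∀ n, ((hmem n).toLp _ : ℝ → _) t = i (u n t) :=
    ae_all_iff.2 fun n => (hmem n).coeFn_toLp
  have hfin : ∀ᵐ t ∂(volume.restrict (Icc 0 T)), 
      liminf (fun k => ‖u (φ (ψ k)) t‖ₑ ^ r) atTop < ⊤ := by
    have hm : ∀ k, Measurable fun t => ‖u (φ (ψ k)) t‖ₑ ^ r := fun k => 
      ((hmeas _).enorm).pow_const r
    refine ae_lt_top (Measurable.liminf hm) ?_
    refine ne_top_of_le_ne_top hAt ((lintegral_liminf_le hm).trans ?_)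
    exact liminf_le_of_le (by isBoundedDefault) fun b hb => by
      obtain ⟨k, hk⟩ := hb.exists
      exact hk.trans (hA1 _)
  have hrange : ∀ᵐ t ∂(volume.restrict (Icc 0 T)), ∃ b : B, c b = (V : ℝ → _) t := by
    filter_upwards [hae, hcoe, hfin] with t h1 h2 h3
    obtain ⟨R, hR1, hR2⟩ := exists_between h3
    have hfr := frequently_lt_of_liminf_lt (by isBoundedDefault) hR1
    obtain ⟨K, hK, hKs⟩ := IsCompactOperator.image_closedBall_subset_compact 
      (f := (i₀ : B₀ →ₗ[ℝ] B)) hcpt (R ^ (1/r)).toReal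
    have hcK : IsClosed (c '' K) := (hK.image c.continuous).isClosed
    have : (V : ℝ → _) t ∈ c '' K := by
      refine hcK.mem_of_frequently_of_tendsto ?_ h1
      refine hfr.mono fun k hk => ?_
      simp only [Function.comp]
      rw [h2, hiapp]
      refine ⟨_, hKs ⟨_, ?_, rfl⟩, rfl⟩
      rw [mem_closedBall_zero_iff]
      have h4 : ‖u (φ (ψ k)) t‖ₑ ≤ R ^ (1/r) := by
        rw [one_div, ENNReal.le_rpow_inv_iff hr0]
        exact hk.le
      simpa using ENNReal.toReal_mono 
        (ENNReal.rpow_ne_top_of_nonneg (by positivity) hR2.ne) h4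
    obtain ⟨b, -, hb⟩ := this
    exact ⟨b, hb⟩
  classical
  set v : ℝ → B := fun t => if h : ∃ b : B, c b = (V : ℝ → _) t then h.choose else 0 with hv
  have hvV : (fun t => c (v t)) =ᵐ[volume.restrict (Icc 0 T)] V := by
    filter_upwards [hrange] with t ht
    simp only [hv, dif_pos ht]
    exact ht.choose_spec
  have hVm := Lp.memLp V
  refine ⟨φ, hφ, v, ?_, ?_, ?_⟩
  · rw [← c.isometry.isEmbedding.aestronglyMeasurable_comp_iff]
    exact hVm.1.congr hvV.symm
  · have h1 := hVm.2
    rw [eLpNorm_lt_top_iff_lintegral_rpow_enorm_lt_top hp0 hpt, hpr] at h1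
    refine lt_of_eq_of_lt (lintegral_congr_ae ?_) h1
    filter_upwards [hvV] with t ht
    rw [← ht, LinearIsometry.enorm_map]
  · rw [Lp.tendsto_Lp_iff_tendsto_eLpNorm'] at hV
    have h1 := hV.ennrpow_const r
    rw [ENNReal.zero_rpow_of_pos hr0] at h1
    refine h1.congr fun k => ?_
    rw [eLpNorm_eq_lintegral_rpow_enorm_toReal hp0 hpt, hpr, ← ENNReal.rpow_mul, one_div,
      inv_mul_cancel₀ hr0.ne', ENNReal.rpow_one]
    refine lintegral_congr_ae ?_
    filter_upwards [hvV, hcoe] with t h2 h3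
    simp only [Pi.sub_apply, Function.comp]
    rw [h3, ← h2, hiapp, ← map_sub, LinearIsometry.enorm_map]
end

section
/- Let T > 0, let X, B₁, …, B_n be Banach spaces (n ∈ ℕ) such that each embedding B_i ⊂ X is compact, and let α_i ∈ (0,1), p_i ∈ (1,∞) satisfy α_i p_i > 1 for every i = 1, …, n. Then the sum space 𝒲^{α₁,p₁}([0,T];B₁) + ⋯ + 𝒲^{α_n,p_n}([0,T];B_n) embeds compactly into C([0,T];X): every sequence of the form u_m = v_{m,1} + ⋯ + v_{m,n} with sup_m ‖v_{m,i}‖_{𝒲^{α_i,p_i}([0,T];B_i)} < ∞ for each i admits, after modification of each u_m on a Lebesgue-null subset of [0,T], a subsequence that converges uniformly on [0,T] to a continuous function [0,T] → X. -/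
open MeasureTheory Filter Set
open scoped ENNReal NNReal

lemma fs_young (x d h α p : ℝ) (hx : 0 ≤ x) (hh : 0 < h) (hd : 0 ≤ d) (hdh : d ≤ h)
    (hd0 : d = 0 → x = 0) (hp : 1 < p) (hαp : 1 < α * p) :
    ENNReal.ofReal x ≤ ENNReal.ofReal (h ^ (α - 1 / p)) *
      (1 + ENNReal.ofReal (h ^ 2) *
        ((ENNReal.ofReal x) ^ p / ENNReal.ofReal (d ^ (1 + α * p)))) := by
  have hβ : 0 < h ^ (α - 1 / p) := Real.rpow_pos_of_pos hh _
  rcases le_or_gt x (h ^ (α - 1 / p)) with hle | hlt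
  · calc ENNReal.ofReal x ≤ ENNReal.ofReal (h ^ (α - 1 / p)) * 1 := by
          rw [mul_one]; exact ENNReal.ofReal_le_ofReal hle
      _ ≤ _ := by gcongr; exact le_self_add
  · have hx0 : 0 < x := hβ.trans hlt
    have hd1 : 0 < d := lt_of_le_of_ne hd (fun h => hx0.ne' (hd0 h.symm))
    rw [ENNReal.ofReal_rpow_of_pos hx0, ← ENNReal.ofReal_div_of_pos (by positivity),
      ← ENNReal.ofReal_mul (by positivity)]
    refine le_trans ?_ (mul_le_mul_right le_add_self _)
    rw [← ENNReal.ofReal_mul (by positivity)]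
    apply ENNReal.ofReal_le_ofReal
    have h1 : x * (h ^ (α - 1 / p)) ^ (p - 1) ≤ x ^ p := by
      calc x * (h ^ (α - 1 / p)) ^ (p - 1) ≤ x * x ^ (p - 1) := by
            gcongr
        _ = x ^ p := by
            rw [← Real.rpow_one_add' hx0.le (by linarith)]; congr 1; ring
    have h2 : d ^ (1 + α * p) ≤ h ^ (1 + α * p) := by
      apply Real.rpow_le_rpow hd hdh; linarith
    have h3 : h ^ (α - 1 / p) * (h ^ 2 * (h ^ (α - 1 / p)) ^ (p - 1)) = h ^ (1 + α * p) := by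
      rw [← Real.rpow_mul hh.le, ← Real.rpow_natCast h 2, ← Real.rpow_add hh, ← Real.rpow_add hh]
      congr 1
      have : p ≠ 0 := by linarith
      field_simp
      push_cast
      ring
    rw [← mul_div_assoc, ← mul_div_assoc, le_div_iff₀ (by positivity)]
    calc x * d ^ (1 + α * p) ≤ x * h ^ (1 + α * p) := by gcongr
      _ = h ^ (α - 1 / p) * (h ^ 2 * (x * (h ^ (α - 1 / p)) ^ (p - 1))) := by rw [← h3]; ring
      _ ≤ _ := by gcongr

lemma fs_young_vec {E : Type*} [NormedAddCommGroup E] (v : ℝ → E) (a b h α p : ℝ) (hh : 0 < h)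
    (hdh : |a - b| ≤ h) (hp : 1 < p) (hαp : 1 < α * p) :
    ‖v a - v b‖ₑ ≤ ENNReal.ofReal (h ^ (α - 1 / p)) *
      (1 + ENNReal.ofReal (h ^ 2) *
        ((‖v a - v b‖₊ : ℝ≥0∞) ^ p / ENNReal.ofReal (|a - b| ^ (1 + α * p)))) := by
  have := fs_young ‖v a - v b‖ |a - b| h α p (norm_nonneg _) hh (abs_nonneg _) hdh
    (by intro h0; have : a = b := by simpa [sub_eq_zero] using h0
        simp [this]) hp hαp
  simpa [ofReal_norm, enorm_eq_nnnorm] using this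

/-- the step -/
lemma fs_step {E : Type*} [NormedAddCommGroup E] (v : ℝ → E) (hv : StronglyMeasurable v)
    (c : E) (T h α p : ℝ) (hh : 0 < h) (hp : 1 < p) (hαp : 1 < α * p) (I J : Set ℝ)
    (hIm : MeasurableSet I) (hJm : MeasurableSet J) (hJI : J ⊆ I) (hI : I ⊆ Icc 0 T)
    (hvI : volume I = ENNReal.ofReal h) (hvJ : volume J = ENNReal.ofReal (h / 2))
    (hdiam : ∀ a ∈ I, ∀ b ∈ I, |a - b| ≤ h) (D : ℝ≥0∞)
    (hD : ∫⁻ t in Icc (0:ℝ) T, ∫⁻ s in Icc (0:ℝ) T,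
              (‖v t - v s‖₊ : ℝ≥0∞) ^ p / ENNReal.ofReal (|t - s| ^ (1 + α * p)) ≤ D) :
    (∫⁻ y in I, ‖v y - c‖ₑ) / volume I ≤ (∫⁻ y in J, ‖v y - c‖ₑ) / volume J +
      ENNReal.ofReal (h ^ (α - 1 / p)) * (1 + 2 * D) := by
  set k : ℝ → ℝ → ℝ≥0∞ := fun t s =>
    (‖v t - v s‖₊ : ℝ≥0∞) ^ p / ENNReal.ofReal (|t - s| ^ (1 + α * p)) with hk
  set C := ENNReal.ofReal (h ^ (α - 1 / p)) with hC
  set H := ENNReal.ofReal (h ^ 2) with hH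
  have hm : Measurable (fun y => ‖v y - c‖ₑ) :=
    (hv.sub stronglyMeasurable_const).enorm
  have hCt : C ≠ ⊤ := ENNReal.ofReal_ne_top
  have hHt : H ≠ ⊤ := ENNReal.ofReal_ne_top
  have hkD : ∫⁻ a in I, ∫⁻ b in J, k a b ≤ D := by
    refine le_trans ?_ hD
    refine (lintegral_mono' (Measure.restrict_mono hI le_rfl) fun a => ?_)
    exact lintegral_mono' (Measure.restrict_mono (hJI.trans hI) le_rfl) le_rfl
  have key : (∫⁻ a in I, ‖v a - c‖ₑ) * volume J ≤
      (∫⁻ b in J, ‖v b - c‖ₑ) * volume I + C * (volume I * volume J + H * D) := by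
    calc (∫⁻ a in I, ‖v a - c‖ₑ) * volume J
        = ∫⁻ a in I, ∫⁻ b in J, ‖v a - c‖ₑ := by
          simp only [lintegral_const, Measure.restrict_apply_univ]
          rw [lintegral_mul_const _ hm]
      _ ≤ ∫⁻ a in I, ∫⁻ b in J, (‖v b - c‖ₑ + C * (1 + H * k a b)) := by
          refine setLIntegral_mono' hIm fun a ha => setLIntegral_mono' hJm fun b hb => ?_
          have h1 := fs_young_vec v a b h α p hh (hdiam a ha b (hJI hb)) hp hαp
          calc ‖v a - c‖ₑ = ‖(v b - c) + (v a - v b)‖ₑ := by congr 1; abel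
            _ ≤ ‖v b - c‖ₑ + ‖v a - v b‖ₑ := enorm_add_le _ _
            _ ≤ _ := by gcongr
      _ = (∫⁻ b in J, ‖v b - c‖ₑ) * volume I +
            C * (volume I * volume J + H * ∫⁻ a in I, ∫⁻ b in J, k a b) := by
          have : ∀ a, ∫⁻ b in J, (‖v b - c‖ₑ + C * (1 + H * k a b)) =
              (∫⁻ b in J, ‖v b - c‖ₑ) + C * (volume J + H * ∫⁻ b in J, k a b) := by
            intro a
            rw [lintegral_add_left hm, lintegral_const_mul' _ _ hCt,
              lintegral_add_left measurable_const, lintegral_const_mul' _ _ hHt]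
            simp
          simp only [this]
          rw [lintegral_add_left measurable_const, lintegral_const_mul' _ _ hCt,
              lintegral_add_left measurable_const, lintegral_const_mul' _ _ hHt]
          simp [mul_comm]
      _ ≤ _ := by gcongr
  have hI0 : volume I ≠ 0 := by rw [hvI]; simpa using hh
  have hJ0 : volume J ≠ 0 := by rw [hvJ]; simpa using hh
  have hIt : volume I ≠ ⊤ := by rw [hvI]; simp
  have hJt : volume J ≠ ⊤ := by rw [hvJ]; simp
  have hHIJ : H = 2 * (volume I * volume J) := by
    rw [hvI, hvJ, ← ENNReal.ofReal_mul hh.le, hH, ← ENNReal.ofReal_ofNat 2,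
      ← ENNReal.ofReal_mul (by norm_num)]
    congr 1; ring
  rw [ENNReal.div_le_iff hI0 hIt]
  rw [← ENNReal.mul_le_mul_iff_left hJ0 hJt]
  refine key.trans (le_of_eq ?_)
  rw [hHIJ, add_mul, add_mul]
  congr 1
  · rw [mul_right_comm, ENNReal.div_mul_cancel hJ0 hJt]
  · ring

lemma fs_chain {E : Type*} [NormedAddCommGroup E] (v : ℝ → E) (hv : StronglyMeasurable v)
    (c : E) (T h α p : ℝ) (hh : 0 < h) (hp : 1 < p) (hαp : 1 < α * p) (I : ℕ → Set ℝ)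
    (hIm : ∀ k, MeasurableSet (I k)) (hJI : ∀ k, I (k + 1) ⊆ I k) (hI : ∀ k, I k ⊆ Icc 0 T)
    (hvI : ∀ k, volume (I k) = ENNReal.ofReal (h / 2 ^ k))
    (hdiam : ∀ k, ∀ a ∈ I k, ∀ b ∈ I k, |a - b| ≤ h / 2 ^ k) (D : ℝ≥0∞)
    (hD : ∫⁻ t in Icc (0:ℝ) T, ∫⁻ s in Icc (0:ℝ) T,
              (‖v t - v s‖₊ : ℝ≥0∞) ^ p / ENNReal.ofReal (|t - s| ^ (1 + α * p)) ≤ D)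
    (hlim : Tendsto (fun k => (∫⁻ y in I k, ‖v y - c‖ₑ) / volume (I k)) atTop (nhds 0)) :
    (∫⁻ y in I 0, ‖v y - c‖ₑ) / volume (I 0) ≤
      ENNReal.ofReal (h ^ (α - 1 / p) * (1 - (1 / 2) ^ (α - 1 / p))⁻¹) * (1 + 2 * D) := by
  set β := α - 1 / p with hβ
  have hβ0 : 0 < β := by
    rw [hβ, sub_pos, div_lt_iff₀ (by linarith)]; exact hαp
  set q : ℝ := (1 / 2) ^ β with hq
  have hq0 : 0 ≤ q := by positivity
  have hq1 : q < 1 := Real.rpow_lt_one (by norm_num) (by norm_num) hβ0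
  have hpow : ∀ k : ℕ, (h / 2 ^ k) ^ β = h ^ β * q ^ k := by
    intro k
    rw [hq, Real.rpow_pow_comm (by norm_num), ← Real.mul_rpow hh.le (by positivity)]
    congr 1
    rw [one_div, inv_pow, div_eq_mul_inv]
  have hind : ∀ k, (∫⁻ y in I 0, ‖v y - c‖ₑ) / volume (I 0) ≤
      (∫⁻ y in I k, ‖v y - c‖ₑ) / volume (I k) +
      ENNReal.ofReal (h ^ β * ∑ j ∈ Finset.range k, q ^ j) * (1 + 2 * D) := by
    intro k
    induction k with
    | zero => simp
    | succ k ih =>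
      have := fs_step v hv c T (h / 2 ^ k) α p (by positivity) hp hαp (I k) (I (k + 1)) (hIm _)
        (hIm _) (hJI k) (hI k) (hvI k) (by rw [hvI]; congr 1; rw [pow_succ]; field_simp)
        (hdiam k) D hD
      refine ih.trans ?_
      refine (add_le_add_left this _).trans (le_of_eq ?_)
      rw [← hβ, hpow, Finset.sum_range_succ, mul_add (h ^ β), ENNReal.ofReal_add
        (mul_nonneg (by positivity) (Finset.sum_nonneg fun _ _ => by positivity)) (by positivity)]
      ring
  have hind2 : ∀ k, (∫⁻ y in I 0, ‖v y - c‖ₑ) / volume (I 0) ≤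
      (∫⁻ y in I k, ‖v y - c‖ₑ) / volume (I k) +
      ENNReal.ofReal (h ^ β * (1 - q)⁻¹) * (1 + 2 * D) := by
    intro k
    refine (hind k).trans ?_
    gcongr
    rw [← tsum_geometric_of_lt_one hq0 hq1]
    exact (summable_geometric_of_lt_one hq0 hq1).sum_le_tsum _ (fun _ _ => by positivity)
  have := ge_of_tendsto' (hlim.add_const (ENNReal.ofReal (h ^ β * (1 - q)⁻¹) * (1 + 2 * D))) hind2
  simpa using this

lemma fs_holder_aux {E : Type*} [NormedAddCommGroup E] (v : ℝ → E) (hv : StronglyMeasurable v)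
    (T α p : ℝ) (hp : 1 < p) (hαp : 1 < α * p) (D : ℝ≥0∞)
    (hD : ∫⁻ t in Icc (0:ℝ) T, ∫⁻ s in Icc (0:ℝ) T,
              (‖v t - v s‖₊ : ℝ≥0∞) ^ p / ENNReal.ofReal (|t - s| ^ (1 + α * p)) ≤ D)
    (Good : ℝ → Prop) (hGood : ∀ x, Good x → Tendsto (fun a => (∫⁻ y in a,
      ‖(Icc (0:ℝ) T).indicator v y - (Icc (0:ℝ) T).indicator v x‖ₑ) / volume a)
      ((IsUnifLocDoublingMeasure.vitaliFamily (volume : Measure ℝ) 1).filterAt x) (nhds 0))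
    (s t : ℝ) (hs : s ∈ Icc 0 T) (ht : t ∈ Icc 0 T) (hst : s < t) (hgs : Good s) (hgt : Good t) :
    ‖v t - v s‖ₑ ≤
      2 * (ENNReal.ofReal ((t - s) ^ (α - 1 / p) * (1 - (1 / 2) ^ (α - 1 / p))⁻¹) *
        (1 + 2 * D)) := by
  set h := t - s with hh
  have hh0 : 0 < h := sub_pos.2 hst
  have hpos : ∀ k : ℕ, 0 < h / 2 ^ k := fun k => by positivity
  have hle : ∀ k : ℕ, h / 2 ^ k ≤ h := fun k =>
    div_le_self hh0.le (one_le_pow₀ (by norm_num))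
  have hanti : ∀ k : ℕ, h / 2 ^ (k + 1) ≤ h / 2 ^ k := fun k => by
    rw [pow_succ, ← div_div]; exact div_le_self (hpos k).le (by norm_num)
  have hlim0 : Tendsto (fun k : ℕ => h / 2 ^ k) atTop (nhds 0) := by
    have := (tendsto_pow_atTop_nhds_zero_of_lt_one (r := (1 / 2 : ℝ)) (by norm_num)
      (by norm_num)).const_mul h
    simpa [div_eq_mul_inv] using this
  have hind : ∀ x ∈ Icc (0:ℝ) T, ∀ I ⊆ Icc (0:ℝ) T, MeasurableSet I →
      ∫⁻ y in I, ‖(Icc (0:ℝ) T).indicator v y - (Icc (0:ℝ) T).indicator v x‖ₑ =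
      ∫⁻ y in I, ‖v y - v x‖ₑ := by
    intro x hx I hI hIm
    refine setLIntegral_congr_fun hIm fun y hy => ?_
    simp only [indicator_of_mem hx, indicator_of_mem (hI hy)]
  have h1 := fs_chain v hv (v s) T h α p hh0 hp hαp (fun k => Icc s (s + h / 2 ^ k))
    (fun k => measurableSet_Icc) (fun k => Icc_subset_Icc le_rfl (by linarith [hanti k]))
    (fun k => Icc_subset_Icc hs.1 (by linarith [hle k, ht.2])) (fun k => by simp)
    (fun k a ha b hb => by
      rw [abs_le]; constructor <;> linarith [ha.1, ha.2, hb.1, hb.2]) D hD (by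
      have hl : Tendsto (fun k : ℕ => s + h / 2 ^ k) atTop (nhdsWithin s (Ioi s)) := by
        rw [tendsto_nhdsWithin_iff]
        exact ⟨by simpa using hlim0.const_add s, Eventually.of_forall fun k => by
          simpa using hpos k⟩
      refine ((hGood s hgs).comp ((Real.tendsto_Icc_vitaliFamily_right s).comp hl)).congr ?_
      intro k
      simp only [Function.comp]
      rw [hind s hs _ (Icc_subset_Icc hs.1 (by linarith [hle k, ht.2])) measurableSet_Icc])
  have h2 := fs_chain v hv (v t) T h α p hh0 hp hαp (fun k => Icc (t - h / 2 ^ k) t)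
    (fun k => measurableSet_Icc) (fun k => Icc_subset_Icc (by linarith [hanti k]) le_rfl)
    (fun k => Icc_subset_Icc (by linarith [hle k, hs.1]) ht.2) (fun k => by simp)
    (fun k a ha b hb => by
      rw [abs_le]; constructor <;> linarith [ha.1, ha.2, hb.1, hb.2]) D hD (by
      have hl : Tendsto (fun k : ℕ => t - h / 2 ^ k) atTop (nhdsWithin t (Iio t)) := by
        rw [tendsto_nhdsWithin_iff]
        exact ⟨by simpa using hlim0.const_sub t, Eventually.of_forall fun k => by
          simpa using hpos k⟩
      refine ((hGood t hgt).comp ((Real.tendsto_Icc_vitaliFamily_left t).comp hl)).congr ?_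
      intro k
      simp only [Function.comp]
      rw [hind t ht _ (Icc_subset_Icc (by linarith [hle k, hs.1]) ht.2) measurableSet_Icc])
  have e1 : s + h / 2 ^ 0 = t := by rw [hh]; simp
  have e2 : t - h / 2 ^ 0 = s := by rw [hh]; simp
  simp only [e1] at h1
  simp only [e2] at h2
  have hv0 : volume (Icc s t) ≠ 0 := by simpa using hst
  have hvt : volume (Icc s t) ≠ ⊤ := by simp
  have hm : Measurable (fun y => ‖v y - v s‖ₑ) :=
    (hv.sub stronglyMeasurable_const).enorm
  have h3 : ‖v t - v s‖ₑ * volume (Icc s t) ≤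
      (∫⁻ y in Icc s t, ‖v y - v s‖ₑ) + ∫⁻ y in Icc s t, ‖v y - v t‖ₑ := by
    rw [← lintegral_add_left hm, ← setLIntegral_const]
    refine lintegral_mono fun y => ?_
    calc ‖v t - v s‖ₑ = ‖(v y - v s) - (v y - v t)‖ₑ := by congr 1; abel
      _ ≤ _ := enorm_sub_le
  rw [← ENNReal.le_div_iff_mul_le (Or.inl hv0) (Or.inl hvt), ENNReal.add_div] at h3
  refine h3.trans ?_
  rw [two_mul]
  exact add_le_add h1 h2

lemma fs_le_one_add (x : ℝ≥0∞) (p : ℝ) (hp : 1 < p) : x ≤ 1 + x ^ p := by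
  rcases le_total x 1 with h | h
  · exact h.trans le_self_add
  · refine le_trans ?_ le_add_self
    exact ENNReal.le_rpow_self_of_one_le h hp.le

lemma fs_main {E : Type*} [NormedAddCommGroup E]
    (T α p : ℝ) (hT : 0 < T) (hp : 1 < p) (hαp : 1 < α * p) (M : ℝ≥0∞) (hM : M < ⊤) :
    ∃ C R : ℝ, ∀ v : ℝ → E, StronglyMeasurable v →
      ((∫⁻ t in Icc (0:ℝ) T, (‖v t‖₊ : ℝ≥0∞) ^ p)
          + ∫⁻ t in Icc (0:ℝ) T, ∫⁻ s in Icc (0:ℝ) T,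
              (‖v t - v s‖₊ : ℝ≥0∞) ^ p
                / ENNReal.ofReal (|t - s| ^ (1 + α * p))) ^ (1 / p) ≤ M →
      ∃ N : Set ℝ, volume N = 0 ∧ ∀ t ∈ Icc (0:ℝ) T \ N, ‖v t‖ ≤ R ∧
        ∀ s ∈ Icc (0:ℝ) T \ N, ‖v t - v s‖ ≤ C * |t - s| ^ (α - 1 / p) := by
  have hβ0 : 0 < α - 1 / p := by
    rw [sub_pos, div_lt_iff₀ (by linarith)]; exact hαp
  set β := α - 1 / p with hβ
  set D := M ^ p with hDdef
  have hDt : D ≠ ⊤ := ENNReal.rpow_ne_top_of_nonneg (by linarith) hM.ne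
  have hq1 : (1 / 2 : ℝ) ^ β < 1 := Real.rpow_lt_one (by norm_num) (by norm_num) hβ0
  set S := (1 - (1 / 2 : ℝ) ^ β)⁻¹ with hS
  have hS0 : 0 < S := inv_pos.2 (sub_pos.2 hq1)
  set C := 2 * S * (1 + 2 * D.toReal) with hC
  have hC0 : 0 ≤ C := by positivity
  set R' : ℝ≥0∞ := ((1 + ENNReal.ofReal (C * T ^ β)) * ENNReal.ofReal T + D) / ENNReal.ofReal T
    with hR'
  have hT0 : ENNReal.ofReal T ≠ 0 := by simpa using hT
  have hR't : R' ≠ ⊤ := by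
    refine ENNReal.div_ne_top ?_ hT0
    finiteness
  refine ⟨C, R'.toReal, fun v hv hvM => ?_⟩
  have hsum := (ENNReal.rpow_inv_le_iff (by linarith : 0 < p)).1 (by simpa using hvM)
  have hL : ∫⁻ t in Icc (0:ℝ) T, (‖v t‖₊ : ℝ≥0∞) ^ p ≤ D := le_self_add.trans hsum
  have hD := le_add_self.trans hsum
  have hle1 : ∀ s, ‖v s‖ₑ ≤ 1 + (‖v s‖₊ : ℝ≥0∞) ^ p := fun s => fs_le_one_add _ p hp
  have hint : Integrable ((Icc (0:ℝ) T).indicator v) := by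
    rw [integrable_indicator_iff measurableSet_Icc]
    refine ⟨hv.aestronglyMeasurable, ?_⟩
    rw [HasFiniteIntegral]
    refine (lintegral_mono hle1).trans_lt ?_
    rw [lintegral_add_left measurable_const]
    refine ENNReal.add_lt_top.2 ⟨by simp, hL.trans_lt hDt.lt_top⟩
  have hae := (IsUnifLocDoublingMeasure.vitaliFamily (volume : Measure ℝ)
    1).ae_tendsto_lintegral_enorm_sub_div hint.locallyIntegrable
  refine ⟨_, ae_iff.1 hae, ?_⟩
  set N : Set ℝ := _ with hN
  change ∀ t ∈ Icc (0:ℝ) T \ N, _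
  have hGood : ∀ x, x ∉ N → Tendsto (fun a => (∫⁻ y in a,
      ‖(Icc (0:ℝ) T).indicator v y - (Icc (0:ℝ) T).indicator v x‖ₑ) / volume a)
      ((IsUnifLocDoublingMeasure.vitaliFamily (volume : Measure ℝ) 1).filterAt x) (nhds 0) := by
    intro x hx
    exact not_not.1 hx
  have hlt : ∀ s t : ℝ, s ∈ Icc (0:ℝ) T \ N → t ∈ Icc (0:ℝ) T \ N → s < t →
      ‖v t - v s‖ ≤ C * (t - s) ^ β := by
    intro s t hs ht hst
    have := fs_holder_aux v hv T α p hp hαp D hD (fun x => x ∉ N) hGood s t hs.1 ht.1 hst hs.2 ht.2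
    have hst' : 0 < t - s := sub_pos.2 hst
    rw [← ofReal_norm] at this
    have h2 : 2 * (ENNReal.ofReal ((t - s) ^ β * S) * (1 + 2 * D)) =
        ENNReal.ofReal (C * (t - s) ^ β) := by
      have : (1 + 2 * D) = ENNReal.ofReal (1 + 2 * D.toReal) := by
        rw [ENNReal.ofReal_add (by norm_num) (by positivity), ENNReal.ofReal_mul (by norm_num),
          ENNReal.ofReal_toReal hDt]; simp
      rw [this, ← ENNReal.ofReal_ofNat 2, ← ENNReal.ofReal_mul (by positivity),
        ← ENNReal.ofReal_mul (by positivity)]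
      congr 1; rw [hC]; ring
    exact (ENNReal.ofReal_le_ofReal_iff (by positivity)).1 (this.trans h2.le)
  have hhol : ∀ t ∈ Icc (0:ℝ) T \ N, ∀ s ∈ Icc (0:ℝ) T \ N,
      ‖v t - v s‖ ≤ C * |t - s| ^ β := by
    intro t ht s hs
    rcases lt_trichotomy s t with h | h | h
    · rw [abs_of_pos (sub_pos.2 h)]; exact hlt s t hs ht h
    · subst h; simp; positivity
    · rw [abs_sub_comm, abs_of_pos (sub_pos.2 h), norm_sub_rev]; exact hlt t s ht hs h
  refine fun t ht => ⟨?_, hhol t ht⟩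
  have hb : ‖v t‖ₑ * ENNReal.ofReal T ≤ (1 + ENNReal.ofReal (C * T ^ β)) * ENNReal.ofReal T + D := by
    have hvol : volume (Icc (0:ℝ) T) = ENNReal.ofReal T := by simp
    calc ‖v t‖ₑ * ENNReal.ofReal T = ∫⁻ s in Icc (0:ℝ) T, ‖v t‖ₑ := by
          rw [setLIntegral_const, hvol]
      _ ≤ ∫⁻ s in Icc (0:ℝ) T, ((1 + ENNReal.ofReal (C * T ^ β)) + (‖v s‖₊ : ℝ≥0∞) ^ p) := by
          refine lintegral_mono_ae ?_
          filter_upwards [ae_restrict_mem measurableSet_Icc, ae_restrict_of_ae hae] with s hs hsN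
          have hs' : s ∈ Icc (0:ℝ) T \ N := ⟨hs, not_not.2 hsN⟩
          have h1 := hhol t ht s hs'
          have h2 : ‖v t - v s‖ₑ ≤ ENNReal.ofReal (C * T ^ β) := by
            rw [← ofReal_norm]
            refine ENNReal.ofReal_le_ofReal (h1.trans ?_)
            gcongr
            rw [abs_le]; constructor <;> linarith [hs.1, hs.2, ht.1.1, ht.1.2]
          calc ‖v t‖ₑ = ‖v s + (v t - v s)‖ₑ := by congr 1; abel
            _ ≤ ‖v s‖ₑ + ‖v t - v s‖ₑ := enorm_add_le _ _
            _ ≤ (1 + (‖v s‖₊ : ℝ≥0∞) ^ p) + ENNReal.ofReal (C * T ^ β) := add_le_add (hle1 s) h2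
            _ = _ := by ring
      _ = (1 + ENNReal.ofReal (C * T ^ β)) * ENNReal.ofReal T +
            ∫⁻ s in Icc (0:ℝ) T, (‖v s‖₊ : ℝ≥0∞) ^ p := by
          rw [lintegral_add_left measurable_const, setLIntegral_const, hvol]
      _ ≤ _ := by gcongr
  rw [← ENNReal.le_div_iff_mul_le (Or.inl hT0) (Or.inl (by simp))] at hb
  rw [← toReal_enorm]
  exact ENNReal.toReal_mono hR't hb

lemma fs_arzela {X : Type*} [NormedAddCommGroup X] (T : ℝ) (G : Set ℝ)
    (hG : G ⊆ Icc 0 T) (hGd : Icc 0 T ⊆ closure G) (K : Set X) (hK : IsCompact K)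
    (u : ℕ → ℝ → X) (huK : ∀ m, ∀ t ∈ G, u m t ∈ K)
    (heq : ∀ ε > 0, ∃ δ > 0, ∀ m, ∀ t ∈ G, ∀ s ∈ G, |t - s| < δ → dist (u m t) (u m s) < ε) :
    ∃ φ : ℕ → ℕ, StrictMono φ ∧ ∃ g : ℝ → X, ContinuousOn g (Icc 0 T) ∧
      TendstoUniformlyOn (fun k => u (φ k)) g atTop G := by
  obtain ⟨Q, hQG, hQc, hGQ⟩ :=
    (TopologicalSpace.IsSeparable.of_separableSpace G).exists_countable_dense_subset
  have hTQ : Icc 0 T ⊆ closure Q := hGd.trans (closure_minimal hGQ isClosed_closure)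
  have : Countable Q := hQc.to_subtype
  have hKc : IsCompact (Set.pi univ (fun _ : Q => K)) := isCompact_univ_pi fun _ => hK
  obtain ⟨a, haK, φ, hφ, hlim⟩ := hKc.isSeqCompact (x := fun m (q : Q) => u m q)
    (fun m q _ => huK m q (hQG q.2))
  rw [tendsto_pi_nhds] at hlim
  obtain ⟨f, hf⟩ : ∃ f : ℝ → X, ∀ q : Q, f q = a q := by
    classical
    exact ⟨fun t => if h : t ∈ Q then a ⟨t, h⟩ else 0, fun q => by simp⟩
  have hfl : ∀ q ∈ Q, Tendsto (fun k => u (φ k) q) atTop (nhds (f q)) := by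
    intro q hq
    have := hlim ⟨q, hq⟩
    rw [← hf] at this
    exact this
  have hfK : ∀ q ∈ Q, f q ∈ K := by
    intro q hq
    rw [hf ⟨q, hq⟩]; exact haK ⟨q, hq⟩ (mem_univ _)
  have hfe : ∀ ε > 0, ∃ δ > 0, ∀ t ∈ Q, ∀ s ∈ Q, |t - s| < δ → dist (f t) (f s) ≤ ε := by
    intro ε hε
    obtain ⟨δ, hδ, h⟩ := heq ε hε
    refine ⟨δ, hδ, fun t ht s hs hts => ?_⟩
    exact le_of_tendsto' ((hfl t ht).dist (hfl s hs))
      fun k => (h (φ k) t (hQG ht) s (hQG hs) hts).le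
  have hex : ∀ x ∈ Icc 0 T, ∃ y, Tendsto f (nhdsWithin x Q) (nhds y) := by
    intro x hx
    haveI := mem_closure_iff_nhdsWithin_neBot.1 (hTQ hx)
    have hc : Cauchy (map f (nhdsWithin x Q)) := by
      rw [Metric.cauchy_iff]
      refine ⟨inferInstance, fun ε hε => ?_⟩
      obtain ⟨δ, hδ, h⟩ := hfe (ε / 2) (by positivity)
      refine ⟨f '' (Metric.ball x (δ / 2) ∩ Q), image_mem_map ?_, ?_⟩
      · exact inter_mem (mem_nhdsWithin_of_mem_nhds (Metric.ball_mem_nhds _ (by positivity)))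
          self_mem_nhdsWithin
      · rintro _ ⟨s, hs, rfl⟩ _ ⟨t, ht, rfl⟩
        refine (h s hs.2 t ht.2 ?_).trans_lt (by linarith)
        rw [← Real.dist_eq]
        refine (dist_triangle_right s t x).trans_lt ?_
        have h1 := Metric.mem_ball.1 hs.1
        have h2 := Metric.mem_ball.1 ht.1
        linarith
    obtain ⟨y, -, hy⟩ := hK.isComplete _ hc (by
      rw [le_principal_iff, mem_map]
      filter_upwards [self_mem_nhdsWithin] with q hq using hfK q hq)
    exact ⟨y, hy⟩
  set g := extendFrom Q f with hg
  have hgc : ContinuousOn g (Icc 0 T) := continuousOn_extendFrom hTQ hex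
  have hgf : ∀ q ∈ Q, g q = f q := by
    intro q hq
    obtain ⟨y, hy⟩ := hex q (hG (hQG hq))
    have h1 : f q = y := by
      have : Tendsto f (pure q) (nhds y) := hy.mono_left (pure_le_nhdsWithin hq)
      exact tendsto_nhds_unique (tendsto_pure_nhds f q) this
    rw [h1]
    exact extendFrom_eq (subset_closure hq) hy
  refine ⟨φ, hφ, g, hgc, ?_⟩
  have hgu := isCompact_Icc.uniformContinuousOn_of_continuous hgc
  rw [Metric.uniformContinuousOn_iff] at hgu
  rw [Metric.tendstoUniformlyOn_iff]
  intro ε hε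
  obtain ⟨δ₁, hδ₁, h₁⟩ := heq (ε / 3) (by positivity)
  obtain ⟨δ₂, hδ₂, h₂⟩ := hgu (ε / 3) (by positivity)
  obtain ⟨F, hFQ, hFf, hF⟩ := isCompact_Icc.elim_finite_subcover_image (b := Q)
    (c := fun q => Metric.ball q (min δ₁ δ₂)) (fun _ _ => Metric.isOpen_ball) (by
      intro x hx
      obtain ⟨q, hq, hd⟩ := Metric.mem_closure_iff.1 (hTQ hx) (min δ₁ δ₂) (lt_min hδ₁ hδ₂)
      exact mem_biUnion hq hd)
  have hev : ∀ᶠ k in atTop, ∀ q ∈ F, dist (u (φ k) q) (g q) < ε / 3 := by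
    rw [eventually_all_finite hFf]
    intro q hq
    rw [hgf q (hFQ hq)]
    exact (Metric.tendsto_nhds.1 (hfl q (hFQ hq))) _ (by positivity)
  filter_upwards [hev] with k hk t ht
  obtain ⟨q, hq, htq⟩ := mem_iUnion₂.1 (hF (hG ht))
  have htq' := Metric.mem_ball.1 htq
  have i1 := h₂ t (hG ht) q (hG (hQG (hFQ hq))) (htq'.trans_le (min_le_right _ _))
  have i2 := h₁ (φ k) t ht q (hQG (hFQ hq)) (by
    rw [← Real.dist_eq]; exact htq'.trans_le (min_le_left _ _))
  have i3 := hk q hq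
  have := dist_triangle4 (g t) (g q) (u (φ k) q) (u (φ k) t)
  rw [dist_comm (g q), dist_comm (u (φ k) q) (u (φ k) t)] at this
  linarith

/-- Compact embedding of the sum `𝒲^{α₁,p₁}([0,T];B₁) + ⋯ + 𝒲^{αₙ,pₙ}([0,T];Bₙ)`
into `C([0,T];X)` (Flandoli–Gątarek, Theorem 2.2). -/
theorem stmt_1
    {X : Type*} [NormedAddCommGroup X] [NormedSpace ℝ X]
    (n : ℕ) (B : Fin n → Type*)
    [∀ i, NormedAddCommGroup (B i)] [∀ i, NormedSpace ℝ (B i)]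
    (ι : ∀ i, B i →L[ℝ] X)
    (hinj : ∀ i, Function.Injective (ι i))
    (hcpt : ∀ i, IsCompactOperator (ι i))
    (T : ℝ) (hT : 0 < T)
    (α p : Fin n → ℝ)
    (hα : ∀ i, α i ∈ Ioo (0:ℝ) 1) (hp : ∀ i, 1 < p i)
    (hαp : ∀ i, 1 < α i * p i)
    (v : ℕ → ∀ i, ℝ → B i)
    (hmeas : ∀ m i, StronglyMeasurable (v m i))
    (hbdd : ∀ i, ∃ M : ℝ≥0∞, M < ⊤ ∧ ∀ m,
      ((∫⁻ t in Icc (0:ℝ) T, (‖v m i t‖₊ : ℝ≥0∞) ^ (p i))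
          + ∫⁻ t in Icc (0:ℝ) T, ∫⁻ s in Icc (0:ℝ) T,
              (‖v m i t - v m i s‖₊ : ℝ≥0∞) ^ (p i)
                / ENNReal.ofReal (|t - s| ^ (1 + α i * p i))) ^ (1 / p i)
        ≤ M) :
    ∃ φ : ℕ → ℕ, StrictMono φ ∧ ∃ w : ℕ → ℝ → X, ∃ g : ℝ → X,
      (∀ k, w k =ᵐ[volume.restrict (Icc (0:ℝ) T)]
        (fun t => ∑ i, ι i (v (φ k) i t))) ∧
      ContinuousOn g (Icc (0:ℝ) T) ∧
      TendstoUniformlyOn w g atTop (Icc (0:ℝ) T) := by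
  classical
  choose M hM hMv using hbdd
  choose C R hCR using fun i => fs_main (E := B i) T (α i) (p i) hT (hp i) (hαp i) (M i) (hM i)
  choose N hN0 hN using fun m i => hCR i (v m i) (hmeas m i) (hMv i m)
  have hβ0 : ∀ i, 0 < α i - 1 / p i := fun i => by
    rw [sub_pos, div_lt_iff₀ (by linarith [hp i])]; exact hαp i
  set NN : Set ℝ := ⋃ m, ⋃ i, N m i with hNN
  have hNN0 : volume NN = 0 := measure_iUnion_null fun m => measure_iUnion_null fun i => hN0 m i
  set G := Icc (0:ℝ) T \ NN with hG
  have hGN : ∀ m i, G ⊆ Icc (0:ℝ) T \ N m i := fun m i t ht =>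
    ⟨ht.1, fun h => ht.2 (mem_iUnion₂.2 ⟨m, i, h⟩)⟩
  have hGd : Icc 0 T ⊆ closure G := by
    have hd : Dense NNᶜ := by
      have : interior NN = ∅ := Measure.interior_eq_empty_of_null hNN0
      exact interior_eq_empty_iff_dense_compl.1 this
    rw [← closure_Ioo hT.ne]
    refine closure_minimal ?_ isClosed_closure
    refine (hd.open_subset_closure_inter isOpen_Ioo).trans (closure_mono ?_)
    exact fun x hx => ⟨Ioo_subset_Icc_self hx.1, hx.2⟩
  choose K hK hKi using fun i =>
    IsCompactOperator.image_closedBall_subset_compact (f := (ι i : B i →ₗ[ℝ] X)) (hcpt i) (R i)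
  set KK : Set X := (fun x : Fin n → X => ∑ i, x i) '' (Set.pi univ K) with hKK
  have hKKc : IsCompact KK := (isCompact_univ_pi hK).image (by fun_prop)
  obtain ⟨φ, hφ, g, hgc, hgu⟩ := fs_arzela T G diff_subset hGd KK hKKc
    (fun m t => ∑ i, ι i (v m i t)) (by
      intro m t ht
      refine ⟨fun i => ι i (v m i t), fun i _ => ?_, rfl⟩
      apply hKi i
      exact ⟨v m i t, by simpa using (hN m i t (hGN m i ht)).1, rfl⟩) (by
      intro ε hε
      have hω : Tendsto (fun h : ℝ => ∑ i, ‖ι i‖ * (C i * |h| ^ (α i - 1 / p i)))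
          (nhds 0) (nhds 0) := by
        have hc : Continuous (fun h : ℝ => ∑ i, ‖ι i‖ * (C i * |h| ^ (α i - 1 / p i))) := by
          refine continuous_finsetSum _ fun i _ => ?_
          exact continuous_const.mul (continuous_const.mul
            (continuous_abs.rpow_const fun x => Or.inr (hβ0 i).le))
        have := hc.tendsto 0
        simpa [fun i => Real.zero_rpow (hβ0 i).ne', -one_div] using this
      obtain ⟨δ, hδ, h⟩ := Metric.tendsto_nhds_nhds.1 hω ε hε
      refine ⟨δ, hδ, fun m t ht s hs hts => ?_⟩
      have h1 := h (x := t - s) (by simpa using hts)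
      rw [dist_zero_right] at h1
      refine lt_of_le_of_lt ?_ ((le_abs_self _).trans_lt h1)
      rw [dist_eq_norm, ← Finset.sum_sub_distrib]
      refine (norm_sum_le _ _).trans (Finset.sum_le_sum fun i _ => ?_)
      rw [← map_sub]
      refine ((ι i).le_opNorm _).trans ?_
      gcongr
      exact (hN m i t (hGN m i ht)).2 s (hGN m i hs))
  refine ⟨φ, hφ, fun k t => if t ∈ G then ∑ i, ι i (v (φ k) i t) else g t, g, ?_, hgc, ?_⟩
  · intro k
    filter_upwards [ae_restrict_mem measurableSet_Icc,
      ae_restrict_of_ae (measure_eq_zero_iff_ae_notMem.1 hNN0)] with t ht htN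
    rw [if_pos ⟨ht, htN⟩]
  · rw [Metric.tendstoUniformlyOn_iff] at hgu ⊢
    intro ε hε
    filter_upwards [hgu ε hε] with k hk t _
    by_cases htG : t ∈ G
    · simp only [if_pos htG]; exact hk t htG
    · simp only [if_neg htG, dist_self]; exact hε
end
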